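/- Let A be a free line arrangement in ℙ² consisting of d = |A| lines, and let m be the maximal multiplicity of an intersection point of A. If 2m ≥ d, then the global Tjurina number of A satisfies Σ_{k≥2} n_k (k−1)² = (d−1)² − (m−1)(d−m). -/

import Mathlib

open scoped LinearAlgebra.Projectivization

noncomputable section

attribute [local instance] Classical.propDecidable

/-- A point of the complex projective plane. -/
abbrev ProjPoint := ℙ ℂ (Fin 3 → ℂ)

/-- A line of the complex projective plane, encoded by a defining linear form
up to scalar, i.e. as a point of the dual projective plane. -/
abbrev ProjLine := ℙ ℂ (Module.Dual ℂ (Fin 3 → ℂ))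

/-- The incidence relation between points and lines of `ℙ²`. -/
def PointOnLine (p : ProjPoint) (L : ProjLine) : Prop :=
  L.rep p.rep = 0

/-- The multiplicity of a point with respect to a line arrangement:
the number of lines of the arrangement passing through the point. -/
def mult (A : Finset ProjLine) (p : ProjPoint) : ℕ :=
  Set.ncard {L : ProjLine | L ∈ A ∧ PointOnLine p L}

/-- An intersection point of a line arrangement: a point lying on at least two lines. -/
def IsIntersectionPoint (A : Finset ProjLine) (p : ProjPoint) : Prop :=
  2 ≤ mult A p

/-- A modular point: an intersection point `p` such that for any other intersection
point `q`, the line through `p` and `q` belongs to the arrangement. -/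
def IsModular (A : Finset ProjLine) (p : ProjPoint) : Prop :=
  IsIntersectionPoint A p ∧
    ∀ q : ProjPoint, IsIntersectionPoint A q → q ≠ p →
      ∃ L ∈ A, PointOnLine p L ∧ PointOnLine q L

/-- A supersolvable line arrangement: one possessing a modular point. -/
def IsSupersolvable (A : Finset ProjLine) : Prop :=
  ∃ p, IsModular A p

/-- An `m`-homogeneous supersolvable line arrangement: supersolvable, and all
modular points have multiplicity `m`. -/
def IsHomogSS (A : Finset ProjLine) (m : ℕ) : Prop :=
  IsSupersolvable A ∧ ∀ p, IsModular A p → mult A p = m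

/-- `nk A k` is the number of intersection points of multiplicity `k` of `A`. -/
def nk (A : Finset ProjLine) (k : ℕ) : ℕ :=
  Set.ncard {p : ProjPoint | IsIntersectionPoint A p ∧ mult A p = k}

/-- A pencil: all lines pass through a common point. -/
def IsPencil (A : Finset ProjLine) : Prop :=
  ∃ p, ∀ L ∈ A, PointOnLine p L

abbrev S3 := MvPolynomial (Fin 3) ℂ

/-- The degree-one polynomial in `ℂ[x,y,z]` associated to a linear form on `ℂ³`. -/
def formToPoly (φ : Module.Dual ℂ (Fin 3 → ℂ)) : S3 :=
  ∑ i : Fin 3, MvPolynomial.C (φ (Pi.single i 1)) * MvPolynomial.X i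

/-- A defining linear equation (in `ℂ[x,y,z]`) of (the cone over) a projective line. -/
def linePoly (L : ProjLine) : S3 := formToPoly L.rep

/-- The module `D(A)` of logarithmic derivations of a line arrangement, viewed as a
central plane arrangement in `ℂ³`. -/
def logDer (A : Finset ProjLine) : Submodule S3 (Derivation ℂ S3 S3) where
  carrier := {θ | ∀ L ∈ A, θ (linePoly L) ∈ Ideal.span {linePoly L}}
  add_mem' := by
    intro θ₁ θ₂ h₁ h₂ L hL
    simpa using Ideal.add_mem _ (h₁ L hL) (h₂ L hL)
  zero_mem' := by
    intro L hL
    simp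
  smul_mem' := by
    intro c θ hθ L hL
    simpa using Ideal.mul_mem_left _ c (hθ L hL)

/-- A line arrangement is free if its module of logarithmic derivations is a free
(graded) module over the polynomial ring `S = ℂ[x,y,z]`. -/
def IsFreeArr (A : Finset ProjLine) : Prop :=
  Module.Free S3 (logDer A)

/-! ### Linear forms -/

open MvPolynomial in
/-- The linear form with coefficient vector `a`. -/
def lin (a : Fin 3 → ℂ) : S3 := ∑ i : Fin 3, C (a i) * X i

open Matrix in
theorem eval_lin (a x : Fin 3 → ℂ) : MvPolynomial.eval x (lin a) = a ⬝ᵥ x := by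
  simp [lin, dotProduct]

theorem lin_isHomogeneous (a : Fin 3 → ℂ) : (lin a).IsHomogeneous 1 :=
  MvPolynomial.IsHomogeneous.sum _ _ _ fun _ _ => MvPolynomial.isHomogeneous_C_mul_X _ _

theorem coeff_lin (a : Fin 3 → ℂ) (i : Fin 3) :
    (lin a).coeff (Finsupp.single i 1) = a i := by
  classical
  rw [lin, MvPolynomial.coeff_sum, Finset.sum_eq_single i]
  · simp
  · intro j _ hji
    rw [MvPolynomial.coeff_C_mul, MvPolynomial.coeff_X, if_neg]
    · simp
    · rwa [Finsupp.single_left_inj Nat.one_ne_zero]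
  · simp

theorem lin_ne_zero {a : Fin 3 → ℂ} (ha : a ≠ 0) : lin a ≠ 0 := by
  intro h
  apply ha
  funext i
  rw [← coeff_lin a i, h]; simp

theorem lin_prime {a : Fin 3 → ℂ} (ha : a ≠ 0) : Prime (lin a) := by
  rw [← irreducible_iff_prime]
  apply MvPolynomial.irreducible_of_totalDegree_eq_one
  · exact (lin_isHomogeneous a).totalDegree (lin_ne_zero ha)
  · intro x hx
    obtain ⟨i, hi⟩ := Function.ne_iff.mp ha
    have := hx (Finsupp.single i 1)
    rw [coeff_lin] at this
    rw [isUnit_iff_ne_zero]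
    rintro rfl
    exact hi (by simpa using this)

open Matrix in
theorem cross_eq_zero_of_lin_dvd {a b : Fin 3 → ℂ} (h : lin a ∣ lin b) :
    crossProduct a b = 0 := by
  obtain ⟨k, hk⟩ := h
  have key : ∀ y : Fin 3 → ℂ, b ⬝ᵥ crossProduct a y = 0 := by
    intro y
    rw [← eval_lin, hk, map_mul, eval_lin]
    simp
  have h0 := key ![1, 0, 0]
  have h1 := key ![0, 1, 0]
  have h2 := key ![0, 0, 1]
  simp [crossProduct, dotProduct, Fin.sum_univ_three] at h0 h1 h2
  funext i
  fin_cases i <;> simp [crossProduct]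
  · linear_combination -h0
  · linear_combination -h1
  · linear_combination -h2

/-! ### Two linear forms with a common prime divisor -/

theorem cross_eq_zero_of_prime_dvd {a b : Fin 3 → ℂ} {π : S3} (hπ : Prime π)
    (ha : π ∣ lin a) (hb : π ∣ lin b) : crossProduct a b = 0 := by
  by_cases h : a = 0
  · subst h; simp
  · have : Associated π (lin a) := hπ.associated_of_dvd (lin_prime h) ha
    exact cross_eq_zero_of_lin_dvd (this.symm.dvd.trans hb)

/-! ### Logarithmic vector fields in coordinates -/

section Coord

variable {ι : Type*}

/-- Pairing of a constant covector with a polynomial vector field. -/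
def pair (a : Fin 3 → ℂ) (t : Fin 3 → S3) : S3 := ∑ i : Fin 3, MvPolynomial.C (a i) * t i

theorem pair_add (a : Fin 3 → ℂ) (s t : Fin 3 → S3) : pair a (s + t) = pair a s + pair a t := by
  simp [pair, mul_add, Finset.sum_add_distrib]

theorem pair_smul (a : Fin 3 → ℂ) (c : S3) (t : Fin 3 → S3) :
    pair a (c • t) = c * pair a t := by
  simp only [pair, Finset.mul_sum, Pi.smul_apply, smul_eq_mul]
  exact Finset.sum_congr rfl fun _ _ => by ring

/-- The constant vector field. -/
def cvec (u : Fin 3 → ℂ) : Fin 3 → S3 := fun i => MvPolynomial.C (u i)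

open Matrix in
theorem pair_cvec (a u : Fin 3 → ℂ) : pair a (cvec u) = MvPolynomial.C (a ⬝ᵥ u) := by
  simp [pair, cvec, dotProduct]

/-- The Euler vector field. -/
def euler : Fin 3 → S3 := fun i => MvPolynomial.X i

theorem pair_euler (a : Fin 3 → ℂ) : pair a euler = lin a := rfl

/-- Logarithmic vector fields, in coordinates. -/
def logVec (A : Finset ι) (a : ι → Fin 3 → ℂ) : Submodule S3 (Fin 3 → S3) where
  carrier := {t | ∀ L ∈ A, lin (a L) ∣ pair (a L) t}
  add_mem' := by
    intro s t hs ht L hL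
    rw [pair_add]
    exact dvd_add (hs L hL) (ht L hL)
  zero_mem' := by
    intro L hL
    simp [pair]
  smul_mem' := by
    intro c t ht L hL
    rw [pair_smul]
    exact Dvd.dvd.mul_left (ht L hL) c

theorem mem_logVec {A : Finset ι} {a : ι → Fin 3 → ℂ} {t : Fin 3 → S3} :
    t ∈ logVec A a ↔ ∀ L ∈ A, lin (a L) ∣ pair (a L) t := Iff.rfl

theorem euler_mem (A : Finset ι) (a : ι → Fin 3 → ℂ) : euler ∈ logVec A a :=
  fun _ _ => dvd_rfl

/-- The function `t ↦ det (euler, t, P)`. -/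
def W (P : Fin 3 → ℂ) : (Fin 3 → S3) →ₗ[S3] S3 where
  toFun t := MvPolynomial.C (P 0) * (MvPolynomial.X 1 * t 2 - MvPolynomial.X 2 * t 1)
    + MvPolynomial.C (P 1) * (MvPolynomial.X 2 * t 0 - MvPolynomial.X 0 * t 2)
    + MvPolynomial.C (P 2) * (MvPolynomial.X 0 * t 1 - MvPolynomial.X 1 * t 0)
  map_add' s t := by simp only [Pi.add_apply]; ring
  map_smul' c t := by simp only [Pi.smul_apply, smul_eq_mul, RingHom.id_apply]; ring

theorem W_apply (P : Fin 3 → ℂ) (t : Fin 3 → S3) : W P t =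
    MvPolynomial.C (P 0) * (MvPolynomial.X 1 * t 2 - MvPolynomial.X 2 * t 1)
    + MvPolynomial.C (P 1) * (MvPolynomial.X 2 * t 0 - MvPolynomial.X 0 * t 2)
    + MvPolynomial.C (P 2) * (MvPolynomial.X 0 * t 1 - MvPolynomial.X 1 * t 0) := rfl

theorem W_cvec (P u : Fin 3 → ℂ) : W P (cvec u) = lin (crossProduct u P) := by
  simp [W_apply, cvec, lin, Fin.sum_univ_three, crossProduct]
  ring

theorem W_eq_det (P : Fin 3 → ℂ) (t : Fin 3 → S3) :
    W P t = Matrix.det (Matrix.of ![euler, t, cvec P]) := by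
  rw [Matrix.det_fin_three]
  simp [W_apply, euler, cvec]
  ring

theorem det_euler_P (P : Fin 3 → ℂ) (h : S3) (t : Fin 3 → S3) :
    Matrix.det (Matrix.of ![euler, h • cvec P, t]) = - (h * W P t) := by
  rw [Matrix.det_fin_three]
  simp [W_apply, euler, cvec]
  ring

open Matrix in
theorem dvd_det {a : Fin 3 → ℂ} (ha : a ≠ 0) {α : S3} (M : Matrix (Fin 3) (Fin 3) S3)
    (h : ∀ i, α ∣ pair a (M i)) : α ∣ M.det := by
  obtain ⟨j, hj⟩ := Function.ne_iff.mp ha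
  have h1 : M.adjugate *ᵥ (M *ᵥ cvec a) = M.det • cvec a := by
    rw [Matrix.mulVec_mulVec, Matrix.adjugate_mul, Matrix.smul_mulVec, Matrix.one_mulVec]
  have h2 : ∀ i, α ∣ (M *ᵥ cvec a) i := by
    intro i
    have : (M *ᵥ cvec a) i = pair a (M i) := by
      simp only [Matrix.mulVec, dotProduct, pair, cvec]
      exact Finset.sum_congr rfl fun _ _ => by ring
    rw [this]; exact h i
  have h3 : α ∣ (M.adjugate *ᵥ (M *ᵥ cvec a)) j := by
    change α ∣ ∑ k, M.adjugate j k * (M *ᵥ cvec a) k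
    exact Finset.dvd_sum fun k _ => Dvd.dvd.mul_left (h2 k) _
  rw [h1] at h3
  have hu : IsUnit (cvec a j) := by
    simpa [cvec] using hj
  simpa [hu.dvd_mul_right] using h3

theorem isRelPrime_lin {a b : Fin 3 → ℂ} (hab : crossProduct a b ≠ 0) :
    IsRelPrime (lin a) (lin b) := by
  have ha : a ≠ 0 := by rintro rfl; simp at hab
  exact ((lin_prime ha).irreducible.isRelPrime_iff_not_dvd).2
    fun h => hab (cross_eq_zero_of_lin_dvd h)

theorem prod_dvd {A : Finset ι} {a : ι → Fin 3 → ℂ}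
    (hne : ∀ L ∈ A, ∀ L' ∈ A, L ≠ L' → crossProduct (a L) (a L') ≠ 0) {F : S3}
    (h : ∀ L ∈ A, lin (a L) ∣ F) : ∏ L ∈ A, lin (a L) ∣ F := by
  apply Finset.prod_dvd_of_isRelPrime
  · intro L hL L' hL' hLL
    exact isRelPrime_lin (hne L hL L' hL' hLL)
  · exact h

open Matrix in
theorem two_forms {a P : Fin 3 → ℂ} (h : a ⬝ᵥ P ≠ 0) :
    ∃ u v : Fin 3 → ℂ, a ⬝ᵥ u = 0 ∧ a ⬝ᵥ v = 0 ∧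
      crossProduct (crossProduct u P) (crossProduct v P) ≠ 0 := by
  obtain ⟨k, hk⟩ : ∃ k, a k * P k ≠ 0 := by
    by_contra hc
    push Not at hc
    exact h (by simp [dotProduct, hc])
  have key : ∀ y z : Fin 3 → ℂ, a ⬝ᵥ crossProduct y z ≠ 0 → ∃ u v : Fin 3 → ℂ,
      a ⬝ᵥ u = 0 ∧ a ⬝ᵥ v = 0 ∧
      crossProduct (crossProduct u P) (crossProduct v P) ≠ 0 := by
    intro y z hyz
    refine ⟨crossProduct a y, crossProduct a z, by simp, by simp, ?_⟩
    intro h0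
    have h1 := congrFun h0 k
    have h2 : (crossProduct (crossProduct (crossProduct a y) P)
      (crossProduct (crossProduct a z) P)) k = (a ⬝ᵥ P) * P k * (a ⬝ᵥ crossProduct y z) := by
      fin_cases k <;> simp [crossProduct, dotProduct, Fin.sum_univ_three] <;> ring
    rw [h2] at h1
    simp [h, hyz] at h1
    simp [h1] at hk
  have hak : a k ≠ 0 := left_ne_zero_of_mul hk
  fin_cases k
  · exact key ![0, 1, 0] ![0, 0, 1] (by simpa [crossProduct, dotProduct, Fin.sum_univ_three])
  · exact key ![0, 0, 1] ![1, 0, 0] (by simpa [crossProduct, dotProduct, Fin.sum_univ_three])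
  · exact key ![1, 0, 0] ![0, 1, 0] (by simpa [crossProduct, dotProduct, Fin.sum_univ_three])

open Matrix in
/-- No prime divides all `W P t / g`. -/
theorem no_common_prime {A : Finset ι} {a : ι → Fin 3 → ℂ}
    (hne : ∀ L ∈ A, ∀ L' ∈ A, L ≠ L' → crossProduct (a L) (a L') ≠ 0)
    (h0 : ∀ L ∈ A, a L ≠ 0) {P : Fin 3 → ℂ} {L₀ : ι} (hL₀ : L₀ ∈ A) (hL₀P : a L₀ ⬝ᵥ P ≠ 0)
    {π : S3} (hπ : Prime π)
    (H : ∀ t ∈ logVec A a, (∏ L ∈ A with a L ⬝ᵥ P = 0, lin (a L)) * π ∣ W P t) : False := by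
  classical
  have step : ∀ L ∈ A, a L ⬝ᵥ P ≠ 0 →
      π ∣ ∏ L' ∈ (A.filter fun L => ¬ a L ⬝ᵥ P = 0).erase L, lin (a L') := by
    intro L hL hLP
    by_contra hnd
    obtain ⟨u, v, hu, hv, huv⟩ := two_forms hLP
    have aux : ∀ u, a L ⬝ᵥ u = 0 → π ∣ lin (crossProduct u P) := by
      intro u hu
      have hmem : (∏ L' ∈ A.erase L, lin (a L')) • cvec u ∈ logVec A a := by
        intro L' hL'
        rw [pair_smul, pair_cvec]
        by_cases hLL : L' = L
        · subst hLL; simp [hu]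
        · exact Dvd.dvd.mul_right (Finset.dvd_prod_of_mem _ (Finset.mem_erase.2 ⟨hLL, hL'⟩)) _
      have h1 := H _ hmem
      rw [map_smul, W_cvec, smul_eq_mul,
        ← Finset.prod_filter_mul_prod_filter_not (A.erase L) (fun L => a L ⬝ᵥ P = 0)] at h1
      have e1 : (A.erase L).filter (fun L => a L ⬝ᵥ P = 0) = A.filter (fun L => a L ⬝ᵥ P = 0) := by
        ext x
        simp only [Finset.mem_filter, Finset.mem_erase]
        constructor
        · rintro ⟨⟨_, h⟩, h'⟩; exact ⟨h, h'⟩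
        · rintro ⟨h, h'⟩; exact ⟨⟨by rintro rfl; exact hLP h', h⟩, h'⟩
      have e2 : (A.erase L).filter (fun L => ¬ a L ⬝ᵥ P = 0)
          = (A.filter (fun L => ¬ a L ⬝ᵥ P = 0)).erase L := by
        ext x
        simp only [Finset.mem_filter, Finset.mem_erase]
        tauto
      rw [e1, e2, mul_assoc] at h1
      have h2 := (mul_dvd_mul_iff_left (Finset.prod_ne_zero_iff.2 fun x hx =>
        lin_ne_zero (h0 x (Finset.mem_filter.1 hx).1))).1 h1
      exact (hπ.dvd_or_dvd h2).resolve_left hnd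
    exact huv (cross_eq_zero_of_prime_dvd hπ (aux u hu) (aux v hv))
  obtain ⟨L₁, hL₁, hd⟩ := (hπ.dvd_finsetProd_iff _).1 (step L₀ hL₀ hL₀P)
  have hL₁' := Finset.mem_filter.1 (Finset.mem_erase.1 hL₁).2
  obtain ⟨L₂, hL₂, hd2⟩ := (hπ.dvd_finsetProd_iff _).1 (step L₁ hL₁'.1 hL₁'.2)
  have hL₂' := Finset.mem_filter.1 (Finset.mem_erase.1 hL₂).2
  exact hne L₂ hL₂'.1 L₁ hL₁'.1 (Finset.mem_erase.1 hL₂).1 (cross_eq_zero_of_prime_dvd hπ hd2 hd)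

/-! ### Graded pieces and the Saito determinant -/

theorem exists_prime_dvd_of_not_isUnit {δ : S3} (h : ¬ IsUnit δ) : ∃ π, Prime π ∧ π ∣ δ := by
  by_cases h0 : δ = 0
  · subst h0
    exact ⟨lin ![1, 0, 0], lin_prime (by intro h; simpa using congrFun h 0), dvd_zero _⟩
  · obtain ⟨π, hπ, hd⟩ := WfDvdMonoid.exists_irreducible_factor h h0
    exact ⟨π, irreducible_iff_prime.1 hπ, hd⟩

attribute [local instance] MvPolynomial.gradedAlgebra

theorem comp_mem {A : Finset ι} {a : ι → Fin 3 → ℂ} {t : Fin 3 → S3} (ht : t ∈ logVec A a)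
    (n : ℕ) : (fun i => MvPolynomial.homogeneousComponent n (t i)) ∈ logVec A a := by
  intro L hL
  have h1 : pair (a L) (fun i => MvPolynomial.homogeneousComponent n (t i))
      = MvPolynomial.homogeneousComponent n (pair (a L) t) := by
    simp [pair, map_sum, MvPolynomial.homogeneousComponent_C_mul]
  rw [h1, ← Ideal.mem_span_singleton]
  apply MvPolynomial.homogeneousComponent_mem_of_mem
  · apply Ideal.homogeneous_span
    rintro x hx
    rw [Set.mem_singleton_iff] at hx
    subst hx
    exact ⟨1, lin_isHomogeneous _⟩
  · exact Ideal.mem_span_singleton.2 (ht L hL)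

theorem homog_mul_const {N F : S3} {d e : ℕ} (hF : F.IsHomogeneous d) (hF0 : F ≠ 0)
    (hN : MvPolynomial.constantCoeff N ≠ 0) (h : (N * F).IsHomogeneous e) :
    e = d ∧ N.totalDegree = 0 := by
  have h1 : MvPolynomial.homogeneousComponent d (N * F)
      = MvPolynomial.homogeneousComponent 0 N * F := by
    have := DirectSum.coe_decompose_mul_of_right_mem_of_le
      (𝒜 := MvPolynomial.homogeneousSubmodule (Fin 3) ℂ) (a := N) (b := F) (i := d) (n := d)
      hF le_rfl
    rw [Nat.sub_self] at this
    have key : ∀ (q : S3) (i : ℕ),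
        (DirectSum.decompose (MvPolynomial.homogeneousSubmodule (Fin 3) ℂ) q i : S3)
          = MvPolynomial.homogeneousComponent i q :=
      fun q i => MvPolynomial.decomposition.decompose'_apply q i
    rw [key, key] at this
    exact this
  have hN0 : N ≠ 0 := by rintro rfl; simp at hN
  have hed : e = d := by
    by_contra hne
    rw [MvPolynomial.homogeneousComponent_of_mem h, if_neg (Ne.symm hne),
      MvPolynomial.homogeneousComponent_zero] at h1
    rcases mul_eq_zero.1 h1.symm with h2 | h2
    · apply hN
      rw [MvPolynomial.constantCoeff_eq]
      simpa using h2
    · exact hF0 h2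
  refine ⟨hed, ?_⟩
  have h3 := h.totalDegree (mul_ne_zero hN0 hF0)
  rw [MvPolynomial.totalDegree_mul_of_isDomain hN0 hF0, hF.totalDegree hF0] at h3
  omega

theorem det_homog (M : Matrix (Fin 3) (Fin 3) S3) (e : Fin 3 → ℕ)
    (h : ∀ i j, (M i j).IsHomogeneous (e i)) : M.det.IsHomogeneous (∑ i, e i) := by
  rw [Matrix.det_apply']
  apply MvPolynomial.IsHomogeneous.sum
  intro σ _
  have h1 : (∏ i, M (σ i) i).IsHomogeneous (∑ i, e i) := by
    have := MvPolynomial.IsHomogeneous.prod Finset.univ (fun i => M (σ i) i) (fun i => e (σ i))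
      fun i _ => h _ _
    rwa [Equiv.sum_comp σ e] at this
  have h2 : ((Equiv.Perm.sign σ : ℤ) : S3) = MvPolynomial.C ((Equiv.Perm.sign σ : ℤ) : ℂ) := by
    simp
  rw [h2]
  exact h1.C_mul _

/-- From a basis, extract homogeneous elements whose coordinate matrix is invertible
at the origin. -/
theorem exists_homog {A : Finset ι} {a : ι → Fin 3 → ℂ}
    (b : Module.Basis (Fin 3) S3 (logVec A a)) :
    ∃ (φ : Fin 3 → logVec A a) (e : Fin 3 → ℕ),
      (∀ i j, ((φ i).1 j).IsHomogeneous (e i)) ∧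
      MvPolynomial.constantCoeff (Matrix.det (Matrix.of fun i j => b.repr (φ i) j)) ≠ 0 := by
  let ρ : logVec A a → (Fin 3 → ℂ) := fun t j => MvPolynomial.constantCoeff (b.repr t j)
  let T : Set (Fin 3 → ℂ) := {v | ∃ t : logVec A a, (∃ n, ∀ j, (t.1 j).IsHomogeneous n) ∧ ρ t = v}
  have hT : ⊤ ≤ Submodule.span ℂ T := by
    have hb : ∀ i, (Pi.single i 1 : Fin 3 → ℂ) ∈ Submodule.span ℂ T := by
      intro i
      let n : ℕ := ∑ j, ((b i).1 j).totalDegree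
      have hsum : b i = ∑ k ∈ Finset.range (n + 1),
          (⟨_, comp_mem (b i).2 k⟩ : logVec A a) := by
        apply Subtype.ext
        rw [Submodule.coe_sum]
        funext j
        rw [Finset.sum_apply]
        have hle : ((b i).1 j).totalDegree + 1 ≤ n + 1 := by
          have := Finset.single_le_sum (f := fun j => ((b i).1 j).totalDegree)
            (fun _ _ => Nat.zero_le _) (Finset.mem_univ j)
          simpa [n] using this
        conv_lhs => rw [← MvPolynomial.sum_homogeneousComponent ((b i).1 j)]
        apply Finset.sum_subset (Finset.range_mono hle)
        intro k _ hk
        apply MvPolynomial.homogeneousComponent_eq_zero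
        simpa using hk
      have hρ : (Pi.single i 1 : Fin 3 → ℂ) = ∑ k ∈ Finset.range (n + 1),
          ρ (⟨_, comp_mem (b i).2 k⟩ : logVec A a) := by
        have h1 : (Pi.single i 1 : Fin 3 → ℂ) = ρ (b i) := by
          funext j
          by_cases hij : i = j
          · subst hij; simp [ρ]
          · simp [ρ, Ne.symm hij]
        rw [h1]
        conv_lhs => rw [hsum]
        funext j
        simp only [ρ, map_sum, Finset.sum_apply, Finsupp.coe_finsetSum]
      rw [hρ]
      refine Submodule.sum_mem _ fun k _ => Submodule.subset_span ⟨_, ⟨k, fun j => ?_⟩, rfl⟩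
      exact MvPolynomial.homogeneousComponent_isHomogeneous _ _
    intro v _
    have : v = ∑ i, v i • (Pi.single i 1 : Fin 3 → ℂ) := by
      funext j; simp [Finset.sum_apply, Pi.single_apply]
    rw [this]
    exact Submodule.sum_mem _ fun i _ => Submodule.smul_mem _ _ (hb i)
  let B := Module.Basis.ofSpan hT
  have hfin : Fintype ↥((linearIndepOn_empty ℂ id).extend (Set.empty_subset T)) :=
    FiniteDimensional.fintypeBasisIndex B
  have hcard : Fintype.card ↥((linearIndepOn_empty ℂ id).extend (Set.empty_subset T)) = 3 := by
    rw [← Module.finrank_eq_card_basis B]; simp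
  let B' : Module.Basis (Fin 3) ℂ (Fin 3 → ℂ) := B.reindex (Fintype.equivFinOfCardEq hcard)
  have hB' : ∀ i, B' i ∈ T := by
    intro i
    apply Module.Basis.ofSpan_subset hT
    simp only [B', Module.Basis.reindex_apply]
    exact Set.mem_range_self _
  choose φ hφ using hB'
  choose e he using fun i => (hφ i).1
  refine ⟨φ, e, he, ?_⟩
  rw [RingHom.map_det]
  have h1 : (MvPolynomial.constantCoeff (R := ℂ) (σ := Fin 3)).mapMatrix
      (Matrix.of fun i j => b.repr (φ i) j) = Matrix.of fun i => B' i := by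
    ext i j
    have := congrFun (hφ i).2 j
    simpa [ρ] using this
  rw [h1]
  have h2 := B'.linearIndependent
  intro h0
  have h3 : IsUnit (Matrix.of fun i => B' i) := Matrix.linearIndependent_rows_iff_isUnit.1 h2
  rw [Matrix.isUnit_iff_isUnit_det, h0] at h3
  simp at h3

theorem det_dvd_of_mem {A : Finset ι} {a : ι → Fin 3 → ℂ}
    (b : Module.Basis (Fin 3) S3 (logVec A a)) (s : Fin 3 → logVec A a) :
    Matrix.det (Matrix.of fun i => (s i).1)
      = Matrix.det (Matrix.of fun i j => b.repr (s i) j) *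
        Matrix.det (Matrix.of fun i => (b i).1) := by
  rw [← Matrix.det_mul]
  congr 1
  ext1 i j
  have h := congrArg Subtype.val (b.sum_repr (s i))
  rw [Submodule.coe_sum] at h
  rw [Matrix.of_apply, ← h, Matrix.mul_apply, Finset.sum_apply]
  simp

open Matrix in
theorem W_eval_zero {A : Finset ι} {a : ι → Fin 3 → ℂ} {P Q : Fin 3 → ℂ} {t : Fin 3 → S3}
    (ht : t ∈ logVec A a) {L₁ L₂ : ι} (h1 : L₁ ∈ A) (h2 : L₂ ∈ A)
    (h12 : crossProduct (a L₁) (a L₂) ≠ 0) (hQ1 : a L₁ ⬝ᵥ Q = 0) (hQ2 : a L₂ ⬝ᵥ Q = 0) :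
    MvPolynomial.eval Q (W P t) = 0 := by
  let τ : Fin 3 → ℂ := fun i => MvPolynomial.eval Q (t i)
  have hτ : ∀ L ∈ A, a L ⬝ᵥ Q = 0 → a L ⬝ᵥ τ = 0 := by
    intro L hL hLQ
    obtain ⟨k, hk⟩ := ht L hL
    have := congrArg (MvPolynomial.eval Q) hk
    rw [map_mul, eval_lin, hLQ, zero_mul] at this
    simpa [pair, dotProduct, τ] using this
  have hc := (Configuration.ofField.crossProduct_eq_zero_of_dotProduct_eq_zero hQ1 hQ2
    (hτ L₁ h1 hQ1) (hτ L₂ h2 hQ2)).resolve_left h12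
  have c0 := congrFun hc 0
  have c1 := congrFun hc 1
  have c2 := congrFun hc 2
  simp [crossProduct] at c0 c1 c2
  simp only [W_apply, map_add, map_mul, map_sub, MvPolynomial.eval_C, MvPolynomial.eval_X]
  change P 0 * (Q 1 * τ 2 - Q 2 * τ 1) + P 1 * (Q 2 * τ 0 - Q 0 * τ 2)
    + P 2 * (Q 0 * τ 1 - Q 1 * τ 0) = 0
  linear_combination P 0 * c0 + P 1 * c1 + P 2 * c2

theorem W_homog (P : Fin 3 → ℂ) {t : Fin 3 → S3} {n : ℕ} (h : ∀ j, (t j).IsHomogeneous n) :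
    (W P t).IsHomogeneous (1 + n) := by
  have hx : ∀ i j, (MvPolynomial.X i * t j : S3).IsHomogeneous (1 + n) := fun i j =>
    (MvPolynomial.isHomogeneous_X _ _).mul (h j)
  rw [W_apply]
  exact ((((hx _ _).sub (hx _ _)).C_mul _).add (((hx _ _).sub (hx _ _)).C_mul _)).add
    (((hx _ _).sub (hx _ _)).C_mul _)

set_option maxHeartbeats 1000000 in
open Matrix in
theorem coord_main {A : Finset ι} {a : ι → Fin 3 → ℂ}
    (hfree : Module.Free S3 (logVec A a))
    (hne : ∀ L ∈ A, ∀ L' ∈ A, L ≠ L' → crossProduct (a L) (a L') ≠ 0)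
    (h0 : ∀ L ∈ A, a L ≠ 0) {P Q : Fin 3 → ℂ} {L₁ L₂ : ι} (h1 : L₁ ∈ A) (h2 : L₂ ∈ A)
    (h12 : crossProduct (a L₁) (a L₂) ≠ 0) (hQ1 : a L₁ ⬝ᵥ Q = 0) (hQ2 : a L₂ ⬝ᵥ Q = 0)
    (hbad : ∀ L ∈ A, a L ⬝ᵥ Q = 0 → a L ⬝ᵥ P ≠ 0)
    (hconst : ∀ v : Fin 3 → ℂ, (∀ L ∈ A, a L ⬝ᵥ v = 0) → v = 0)
    (hd : A.card ≤ 2 * (A.filter fun L => a L ⬝ᵥ P = 0).card) : False := by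
  classical
  set m := (A.filter fun L => a L ⬝ᵥ P = 0).card with hm
  set g : S3 := ∏ L ∈ A with a L ⬝ᵥ P = 0, lin (a L) with hg
  set h : S3 := ∏ L ∈ A with ¬ a L ⬝ᵥ P = 0, lin (a L) with hh
  set f : S3 := ∏ L ∈ A, lin (a L) with hf
  have hf0 : f ≠ 0 := Finset.prod_ne_zero_iff.2 fun L hL => lin_ne_zero (h0 L hL)
  have hgh : g * h = f := Finset.prod_filter_mul_prod_filter_not A (fun L => a L ⬝ᵥ P = 0) _
  have hg0 : g ≠ 0 := by rintro h'; rw [h', zero_mul] at hgh; exact hf0 hgh.symm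
  have hh0 : h ≠ 0 := by rintro h'; rw [h', mul_zero] at hgh; exact hf0 hgh.symm
  have hfd : f.IsHomogeneous A.card := by
    have := MvPolynomial.IsHomogeneous.prod A (fun L => lin (a L)) (fun _ => 1)
      fun L _ => lin_isHomogeneous (a L)
    simpa using this
  have hgd : g.IsHomogeneous m := by
    have := MvPolynomial.IsHomogeneous.prod (A.filter fun L => a L ⬝ᵥ P = 0)
      (fun L => lin (a L)) (fun _ => 1) fun L _ => lin_isHomogeneous (a L)
    simpa using this
  have hPQ := hbad L₁ h1 hQ1
  have noprime := fun (π : S3) (hπ : Prime π) => no_common_prime hne h0 h1 hPQ hπ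
  -- rank three
  have hrank : Module.finrank S3 (logVec A a) = 3 := by
    apply le_antisymm
    · have := Submodule.finrank_le (logVec A a)
      simpa using this
    · let F : (Fin 3 → S3) →ₗ[S3] logVec A a :=
        { toFun := fun t => ⟨f • t, fun L hL => by
            rw [pair_smul]
            exact Dvd.dvd.mul_right (Finset.dvd_prod_of_mem _ hL) _⟩
          map_add' := fun s t => Subtype.ext (smul_add _ _ _)
          map_smul' := fun c t => Subtype.ext (smul_comm _ _ _) }
      have hF : Function.Injective F := by
        intro s t hst
        exact smul_right_injective _ hf0 (congrArg Subtype.val hst)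
      have := LinearMap.finrank_le_finrank_of_injective hF
      simpa using this
  let b : Module.Basis (Fin 3) S3 (logVec A a) :=
    (Module.finBasis S3 (logVec A a)).reindex (finCongr hrank)
  -- `g` divides every `W P t`
  have hgW : ∀ t ∈ logVec A a, g ∣ W P t := by
    intro t ht
    apply prod_dvd
    · intro L hL L' hL'
      exact hne L (Finset.mem_filter.1 hL).1 L' (Finset.mem_filter.1 hL').1
    · intro L hL
      obtain ⟨hLA, hLP⟩ := Finset.mem_filter.1 hL
      rw [W_eq_det]
      apply dvd_det (h0 L hLA)
      intro i
      fin_cases i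
      · exact dvd_of_eq (pair_euler _).symm
      · exact ht L hLA
      · change _ ∣ pair (a L) (cvec P)
        rw [pair_cvec, hLP]; simp
  -- Saito
  obtain ⟨δ, hδ⟩ : f ∣ Matrix.det (Matrix.of fun i => (b i).1) := by
    apply prod_dvd hne
    intro L hL
    exact dvd_det (h0 L hL) _ fun i => (b i).2 L hL
  have hδu : IsUnit δ := by
    by_contra hnu
    obtain ⟨π, hπ, hd⟩ := exists_prime_dvd_of_not_isUnit hnu
    refine noprime π hπ fun t ht => ?_
    have hP : h • cvec P ∈ logVec A a := by
      intro L hL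
      rw [pair_smul, pair_cvec]
      by_cases hLP : a L ⬝ᵥ P = 0
      · simp [hLP]
      · exact Dvd.dvd.mul_right
          (Finset.dvd_prod_of_mem _ (Finset.mem_filter.2 ⟨hL, hLP⟩)) _
    have e1 := det_dvd_of_mem b ![⟨euler, euler_mem A a⟩, ⟨h • cvec P, hP⟩, ⟨t, ht⟩]
    have e2 : (Matrix.of fun i => ((![⟨euler, euler_mem A a⟩, ⟨h • cvec P, hP⟩, ⟨t, ht⟩] :
        Fin 3 → logVec A a) i).1) = Matrix.of ![euler, h • cvec P, t] := by
      ext1 i j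
      fin_cases i <;> rfl
    rw [e2, det_euler_P, hδ] at e1
    have e3 : h * (g * δ) ∣ h * W P t := by
      rw [← dvd_neg, e1, ← hgh]
      rw [show g * h * δ = h * (g * δ) by ring]
      exact dvd_mul_left _ _
    exact (mul_dvd_mul_left g hd).trans ((mul_dvd_mul_iff_left hh0).1 e3)
  -- homogeneous basis
  obtain ⟨φ, e, hφ, hdet⟩ := exists_homog b
  set M : Matrix (Fin 3) (Fin 3) S3 := Matrix.of fun i j => b.repr (φ i) j with hM
  have hΦ := det_dvd_of_mem b φ
  have hΦh : (Matrix.det (Matrix.of fun i => (φ i).1)).IsHomogeneous (∑ i, e i) :=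
    det_homog _ e fun i j => hφ i j
  rw [hδ, ← hM] at hΦ
  have hNf : M.det * (f * δ) = (M.det * δ) * f := by ring
  have hδc : MvPolynomial.constantCoeff δ ≠ 0 := (hδu.map MvPolynomial.constantCoeff).ne_zero
  obtain ⟨hed, hdeg⟩ := homog_mul_const (N := M.det * δ) hfd hf0
    (by rw [map_mul]; exact mul_ne_zero hdet hδc) (by rw [← hNf, ← hΦ]; exact hΦh)
  have hdet0 : M.det ≠ 0 := by intro h'; rw [h'] at hdet; simp at hdet
  have hΦ0 : Matrix.det (Matrix.of fun i => (φ i).1) ≠ 0 := by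
    rw [hΦ]; exact mul_ne_zero hdet0 (mul_ne_zero hf0 hδu.ne_zero)
  have hMu : IsUnit M.det := by
    have : IsUnit (M.det * δ) := MvPolynomial.isUnit_iff_totalDegree_of_isReduced.2
      ⟨by
        rw [← MvPolynomial.constantCoeff_eq, map_mul, isUnit_iff_ne_zero]
        exact mul_ne_zero hdet hδc, hdeg⟩
    exact isUnit_of_mul_isUnit_left this
  -- no constant fields
  have hpos : ∀ i, 1 ≤ e i := by
    intro i
    by_contra hlt
    have hei : e i = 0 := by omega
    let v : Fin 3 → ℂ := fun j => MvPolynomial.coeff 0 ((φ i).1 j)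
    have hv : (φ i).1 = cvec v := by
      funext j
      have := (hφ i j)
      rw [hei] at this
      exact MvPolynomial.totalDegree_eq_zero_iff_eq_C.1
        ((MvPolynomial.totalDegree_zero_iff_isHomogeneous _).2 this)
    have hv0 : v = 0 := by
      apply hconst
      intro L hL
      obtain ⟨k, hk⟩ := (φ i).2 L hL
      rw [hv, pair_cvec] at hk
      have := congrArg (MvPolynomial.eval 0) hk
      rw [map_mul, eval_lin] at this
      simpa using this
    apply hΦ0
    apply Matrix.det_eq_zero_of_row_eq_zero i
    intro j
    rw [Matrix.of_apply, hv, hv0]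
    simp [cvec]
  -- quotients
  choose w hw using fun i => hgW (φ i).1 (φ i).2
  have hgQ : MvPolynomial.eval Q g ≠ 0 := by
    rw [hg, map_prod]
    refine Finset.prod_ne_zero_iff.2 fun L hL => ?_
    obtain ⟨hLA, hLP⟩ := Finset.mem_filter.1 hL
    rw [eval_lin]
    exact fun h' => hbad L hLA h' hLP
  have hwQ : ∀ i, MvPolynomial.eval Q (w i) = 0 := by
    intro i
    have := W_eval_zero (P := P) (φ i).2 h1 h2 h12 hQ1 hQ2
    rw [hw, map_mul] at this
    exact (mul_eq_zero.1 this).resolve_left hgQ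
  have hbig : ∀ i, w i ≠ 0 → m ≤ e i := by
    intro i hi
    have e1 := (W_homog P (hφ i)).totalDegree (by rw [hw]; exact mul_ne_zero hg0 hi)
    rw [hw, MvPolynomial.totalDegree_mul_of_isDomain hg0 hi, hgd.totalDegree hg0] at e1
    have : (w i).totalDegree ≠ 0 := by
      intro hz
      have hC := MvPolynomial.totalDegree_eq_zero_iff_eq_C.1 hz
      have := hwQ i
      rw [hC, MvPolynomial.eval_C] at this
      rw [this] at hC
      exact hi (by simpa using hC)
    omega
  have hone : ∃ i, ∀ j, j ≠ i → w j = 0 := by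
    by_contra hc
    push Not at hc
    rw [Fin.sum_univ_three] at hed
    have p0 := hpos 0
    have p1 := hpos 1
    have p2 := hpos 2
    obtain ⟨i, _, hi⟩ := hc 0
    obtain ⟨j, hji, hj⟩ := hc i
    have b1 := hbig i hi
    have b2 := hbig j hj
    fin_cases i <;> fin_cases j <;> simp at hji b1 b2 <;> omega
  obtain ⟨i, hi⟩ := hone
  have hwu : ¬ IsUnit (w i) := by
    intro hu
    exact (hu.map (MvPolynomial.eval Q)).ne_zero (hwQ i)
  obtain ⟨π, hπ, hπd⟩ := exists_prime_dvd_of_not_isUnit hwu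
  refine noprime π hπ fun t ht => ?_
  -- `M⁻¹` expresses the basis through `φ`
  have hWφ : ∀ j, g * π ∣ W P (φ j).1 := by
    intro j
    rw [hw]
    by_cases hj : j = i
    · subst hj; exact mul_dvd_mul_left g hπd
    · rw [hi j hj]; simp
  have hφb : ∀ j, W P (φ j).1 = (M *ᵥ fun k => W P (b k).1) j := by
    intro j
    have h' := congrArg Subtype.val (b.sum_repr (φ j))
    rw [Submodule.coe_sum] at h'
    rw [← h', map_sum]
    simp [Matrix.mulVec, dotProduct, hM]
  have hWb : ∀ k, g * π ∣ W P (b k).1 := by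
    intro k
    have e1 : M⁻¹ *ᵥ (fun j => W P (φ j).1) = fun k => W P (b k).1 := by
      rw [funext hφb]
      rw [Matrix.mulVec_mulVec, Matrix.nonsing_inv_mul _ hMu, Matrix.one_mulVec]
    rw [← congrFun e1 k]
    change g * π ∣ ∑ j, M⁻¹ k j * W P (φ j).1
    exact Finset.dvd_sum fun j _ => Dvd.dvd.mul_left (hWφ j) _
  have h' := congrArg Subtype.val (b.sum_repr ⟨t, ht⟩)
  rw [Submodule.coe_sum] at h'
  change _ = t at h'
  rw [← h', map_sum]
  refine Finset.dvd_sum fun k _ => ?_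
  rw [Submodule.coe_smul, map_smul]
  exact Dvd.dvd.mul_left (hWb k) _

end Coord

/-! ### Geometry of the projective plane -/

/-- The coefficient vector of a line. -/
def lineVec (L : ProjLine) : Fin 3 → ℂ := fun i => L.rep (Pi.single i 1)

open Matrix in
theorem rep_apply (L : ProjLine) (v : Fin 3 → ℂ) : L.rep v = lineVec L ⬝ᵥ v := by
  rw [LinearMap.pi_apply_eq_sum_univ L.rep v]
  simp only [dotProduct, lineVec, smul_eq_mul]
  refine Finset.sum_congr rfl fun i _ => ?_
  rw [mul_comm]
  congr 2
  funext j
  simp [Pi.single_apply, eq_comm]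

open Matrix in
theorem pointOnLine_iff (p : ProjPoint) (L : ProjLine) :
    PointOnLine p L ↔ lineVec L ⬝ᵥ p.rep = 0 := by
  rw [PointOnLine, rep_apply]

theorem lineVec_ne_zero (L : ProjLine) : lineVec L ≠ 0 := by
  intro h
  apply L.rep_nonzero
  refine LinearMap.ext fun v => ?_
  rw [rep_apply, h]
  simp

/-- A line as a point of the plane, via coordinates. -/
def linePt (L : ProjLine) : ProjPoint := Projectivization.mk ℂ (lineVec L) (lineVec_ne_zero L)

theorem linePt_injective : Function.Injective linePt := by
  intro L L' h
  obtain ⟨c, hc⟩ := (Projectivization.mk_eq_mk_iff' ℂ _ _ _ _).1 h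
  rw [← L.mk_rep, ← L'.mk_rep, Projectivization.mk_eq_mk_iff']
  refine ⟨c, ?_⟩
  refine LinearMap.ext fun v => ?_
  rw [LinearMap.smul_apply, rep_apply, rep_apply, ← hc, smul_dotProduct]

theorem cross_lineVec {L L' : ProjLine} (h : L ≠ L') :
    crossProduct (lineVec L) (lineVec L') ≠ 0 := by
  intro h0
  exact h (linePt_injective ((Projectivization.mk_eq_mk_iff_crossProduct_eq_zero _ _).2 h0))

theorem pointOnLine_iff_orthogonal (p : ProjPoint) (L : ProjLine) :
    PointOnLine p L ↔ (linePt L).orthogonal p := by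
  rw [pointOnLine_iff]
  conv_rhs => rw [← p.mk_rep]
  exact (Projectivization.orthogonal_mk _ _).symm

theorem point_unique {p q : ProjPoint} {L L' : ProjLine} (hL : L ≠ L') (h1 : PointOnLine p L)
    (h2 : PointOnLine p L') (h3 : PointOnLine q L) (h4 : PointOnLine q L') : p = q := by
  rw [pointOnLine_iff_orthogonal] at h1 h2 h3 h4
  exact (Configuration.ofField.eq_or_eq_of_orthogonal h1 h2 h3 h4).resolve_left
    fun h => hL (linePt_injective h)

/-- The meeting point of two lines. -/
def meet (L L' : ProjLine) : ProjPoint := Projectivization.cross (linePt L) (linePt L')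

theorem meet_left {L L' : ProjLine} (h : L ≠ L') : PointOnLine (meet L L') L := by
  rw [pointOnLine_iff_orthogonal]
  exact Projectivization.orthogonal_cross_left fun h' => h (linePt_injective h')

theorem meet_right {L L' : ProjLine} (h : L ≠ L') : PointOnLine (meet L L') L' := by
  rw [pointOnLine_iff_orthogonal]
  exact Projectivization.orthogonal_cross_right fun h' => h (linePt_injective h')

theorem mult_eq (A : Finset ProjLine) (p : ProjPoint) :
    mult A p = (A.filter fun L => PointOnLine p L).card := by
  rw [mult, ← Set.ncard_coe_finset]
  congr 1
  ext L
  simp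

theorem exists_two {A : Finset ProjLine} {p : ProjPoint} (h : IsIntersectionPoint A p) :
    ∃ L ∈ A, ∃ L' ∈ A, L ≠ L' ∧ PointOnLine p L ∧ PointOnLine p L' := by
  rw [IsIntersectionPoint, mult_eq] at h
  obtain ⟨L, hL, L', hL', hne⟩ := Finset.one_lt_card.1 h
  rw [Finset.mem_filter] at hL hL'
  exact ⟨L, hL.1, L', hL'.1, hne, hL.2, hL'.2⟩

theorem isIntersectionPoint_of {A : Finset ProjLine} {p : ProjPoint} {L L' : ProjLine}
    (hL : L ∈ A) (hL' : L' ∈ A) (hne : L ≠ L') (h : PointOnLine p L) (h' : PointOnLine p L') :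
    IsIntersectionPoint A p := by
  rw [IsIntersectionPoint, mult_eq]
  exact Finset.one_lt_card.2 ⟨L, Finset.mem_filter.2 ⟨hL, h⟩, L', Finset.mem_filter.2 ⟨hL', h'⟩, hne⟩

/-! ### Freeness in coordinates -/

theorem derivation_linePoly (θ : Derivation ℂ S3 S3) (L : ProjLine) :
    θ (linePoly L) = pair (lineVec L) (fun i => θ (MvPolynomial.X i)) := by
  simp only [linePoly, formToPoly, pair, lineVec, map_sum, Derivation.leibniz]
  refine Finset.sum_congr rfl fun i _ => ?_
  have : θ (MvPolynomial.C (L.rep (Pi.single i 1))) = 0 := MvPolynomial.derivation_C _ _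
  rw [this]
  simp

theorem free_logVec {A : Finset ProjLine} (h : IsFreeArr A) :
    Module.Free S3 (logVec A lineVec) := by
  have hmem : ∀ θ : Derivation ℂ S3 S3, θ ∈ logDer A ↔
      (fun i => θ (MvPolynomial.X i)) ∈ logVec A lineVec := by
    intro θ
    change (∀ L ∈ A, θ (linePoly L) ∈ Ideal.span {linePoly L}) ↔ _
    rw [mem_logVec]
    refine forall_congr' fun L => forall_congr' fun _ => ?_
    rw [Ideal.mem_span_singleton, derivation_linePoly]
    rfl
  let F : logDer A →ₗ[S3] logVec A lineVec :=
    { toFun := fun θ => ⟨fun i => θ.1 (MvPolynomial.X i), (hmem θ.1).1 θ.2⟩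
      map_add' := fun _ _ => rfl
      map_smul' := fun _ _ => rfl }
  have hF : Function.Bijective F := by
    constructor
    · intro θ θ' hθ
      apply Subtype.ext
      apply MvPolynomial.derivation_ext
      intro i
      exact congrFun (congrArg Subtype.val hθ) i
    · intro t
      refine ⟨⟨MvPolynomial.mkDerivation ℂ t.1, (hmem _).2 ?_⟩, ?_⟩
      · simp [MvPolynomial.mkDerivation_X]
      · apply Subtype.ext
        funext i
        simp [F, MvPolynomial.mkDerivation_X]
  have : Module.Free S3 (logDer A) := h
  exact Module.Free.of_equiv (LinearEquiv.ofBijective F hF)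

open Matrix in
/-- A point of large multiplicity of a free arrangement is modular. -/
theorem modular_of_free {A : Finset ProjLine} (hfree : IsFreeArr A) {p : ProjPoint}
    (hp : IsIntersectionPoint A p) (hd : A.card ≤ 2 * mult A p) : IsModular A p := by
  refine ⟨hp, fun q hq hqp => ?_⟩
  by_contra hbad
  push Not at hbad
  obtain ⟨L₁, h1, L₂, h2, h12, hq1, hq2⟩ := exists_two hq
  obtain ⟨K₁, k1, K₂, k2, k12, hp1, hp2⟩ := exists_two hp
  refine coord_main (P := p.rep) (Q := q.rep) (free_logVec hfree)
    (fun L _ L' _ h => cross_lineVec h) (fun L _ => lineVec_ne_zero L) h1 h2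
    (cross_lineVec h12) ((pointOnLine_iff _ _).1 hq1) ((pointOnLine_iff _ _).1 hq2) ?_ ?_ ?_
  · intro L hL hLq hLp
    exact hbad L hL ((pointOnLine_iff _ _).2 hLp) ((pointOnLine_iff _ _).2 hLq)
  · intro v hv
    by_contra hv0
    have hon : ∀ L ∈ A, PointOnLine (Projectivization.mk ℂ v hv0) L := by
      intro L hL
      rw [pointOnLine_iff_orthogonal]
      exact (Projectivization.orthogonal_mk _ _).2 (hv L hL)
    exact hqp ((point_unique h12 hq1 hq2 (hon _ h1) (hon _ h2)).trans
      (point_unique k12 (hon _ k1) (hon _ k2) hp1 hp2))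
  · rw [mult_eq] at hd
    simpa only [pointOnLine_iff] using hd

/-! ### Counting -/

theorem count_modular {A : Finset ProjLine} {p : ProjPoint} (hp : IsModular A p) :
    ∑ k ∈ Finset.Icc 2 A.card, (nk A k : ℤ) * ((k : ℤ) - 1) ^ 2
      = ((A.card : ℤ) - 1) ^ 2 - ((mult A p : ℤ) - 1) * ((A.card : ℤ) - (mult A p : ℤ)) := by
  classical
  obtain ⟨hpI, hmod⟩ := hp
  have hfin : {q : ProjPoint | IsIntersectionPoint A q}.Finite := by
    refine Set.Finite.subset (((A ×ˢ A).image fun x => meet x.1 x.2).finite_toSet) ?_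
    intro q hq
    obtain ⟨L, hL, L', hL', hne, h, h'⟩ := exists_two hq
    refine Finset.mem_coe.2 (Finset.mem_image.2 ⟨(L, L'), Finset.mem_product.2 ⟨hL, hL'⟩, ?_⟩)
    exact point_unique hne (meet_left hne) (meet_right hne) h h'
  let Q : Finset ProjPoint := hfin.toFinset
  have hQ : ∀ q, q ∈ Q ↔ IsIntersectionPoint A q := fun q => by simp [Q]
  have hnk : ∀ k, nk A k = (Q.filter fun q => mult A q = k).card := by
    intro k
    rw [nk, ← Set.ncard_coe_finset]
    congr 1
    ext q
    simp [hQ]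
  have hsum : ∑ k ∈ Finset.Icc 2 A.card, (nk A k : ℤ) * ((k : ℤ) - 1) ^ 2
      = ∑ q ∈ Q, ((mult A q : ℤ) - 1) ^ 2 := by
    rw [← Finset.sum_fiberwise_of_maps_to (s := Q) (t := Finset.Icc 2 A.card) (g := mult A)]
    · refine Finset.sum_congr rfl fun k _ => ?_
      rw [hnk, Finset.sum_congr rfl (g := fun _ => ((k : ℤ) - 1) ^ 2)]
      · simp
      · intro q hq
        rw [(Finset.mem_filter.1 hq).2]
    · intro q hq
      refine Finset.mem_Icc.2 ⟨(hQ q).1 hq, ?_⟩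
      rw [mult_eq]
      exact Finset.card_filter_le _ _
  rw [hsum]
  let H : Finset ProjLine := A.filter fun L => ¬ PointOnLine p L
  have hH : ∀ L, L ∈ H ↔ L ∈ A ∧ ¬ PointOnLine p L := fun L => Finset.mem_filter
  have hHc : (H.card : ℤ) = A.card - mult A p := by
    have := Finset.card_filter_add_card_filter_not (s := A) (fun L => PointOnLine p L)
    rw [← mult_eq] at this
    have h2 : mult A p + H.card = A.card := this
    omega
  have hone : ∀ q ∈ Q.erase p, (mult A q : ℤ) - 1 = ∑ L ∈ H, if PointOnLine q L then 1 else 0 := by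
    intro q hq
    obtain ⟨hqp, hqQ⟩ := Finset.mem_erase.1 hq
    obtain ⟨K, hK, hKp, hKq⟩ := hmod q ((hQ q).1 hqQ) hqp
    have e1 := Finset.card_filter_add_card_filter_not (s := A.filter fun L => PointOnLine q L)
      (fun L => PointOnLine p L)
    have e2 : (A.filter fun L => PointOnLine q L).filter (fun L => PointOnLine p L) = {K} := by
      ext L
      simp only [Finset.mem_filter, Finset.mem_singleton]
      constructor
      · rintro ⟨⟨_, hLq⟩, hLp⟩
        by_contra hne
        exact hqp (point_unique hne hLq hKq hLp hKp)
      · rintro rfl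
        exact ⟨⟨hK, hKq⟩, hKp⟩
    have e3 : (A.filter fun L => PointOnLine q L).filter (fun L => ¬ PointOnLine p L)
        = H.filter fun L => PointOnLine q L := by
      ext L
      simp only [Finset.mem_filter, hH]
      tauto
    rw [e2, e3, ← mult_eq A q, Finset.card_singleton] at e1
    rw [Finset.sum_boole, ← e1]
    push_cast
    ring
  have hpair : ∀ L ∈ H, ∀ L' ∈ H,
      (((Q.erase p).filter fun q => PointOnLine q L ∧ PointOnLine q L').card : ℤ)
        = if L = L' then (mult A p : ℤ) else 1 := by
    intro L hL L' hL'
    rw [hH] at hL hL'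
    split_ifs with heq
    · subst heq
      rw [mult_eq]
      congr 1
      symm
      refine Finset.card_bij (fun K _ => meet K L) ?_ ?_ ?_
      · intro K hK
        obtain ⟨hKA, hKp⟩ := Finset.mem_filter.1 hK
        have hKL : K ≠ L := by rintro rfl; exact hL.2 hKp
        refine Finset.mem_filter.2 ⟨Finset.mem_erase.2 ⟨?_, (hQ _).2 ?_⟩, meet_right hKL,
          meet_right hKL⟩
        · intro h
          exact hL.2 (h ▸ meet_right hKL)
        · exact isIntersectionPoint_of hKA hL.1 hKL (meet_left hKL) (meet_right hKL)
      · intro K hK K' hK' hKK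
        obtain ⟨hKA, hKp⟩ := Finset.mem_filter.1 hK
        obtain ⟨hKA', hKp'⟩ := Finset.mem_filter.1 hK'
        have hKL : K ≠ L := by rintro rfl; exact hL.2 hKp
        have hKL' : K' ≠ L := by rintro rfl; exact hL.2 hKp'
        by_contra hne
        have := point_unique hne hKp hKp' (meet_left hKL) (hKK ▸ meet_left hKL')
        exact hL.2 (this ▸ meet_right hKL)
      · intro q hq
        obtain ⟨hq1, hqL, _⟩ := Finset.mem_filter.1 hq
        obtain ⟨hqp, hqQ⟩ := Finset.mem_erase.1 hq1
        obtain ⟨K, hK, hKp, hKq⟩ := hmod q ((hQ q).1 hqQ) hqp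
        have hKL : K ≠ L := by rintro rfl; exact hL.2 hKp
        exact ⟨K, Finset.mem_filter.2 ⟨hK, hKp⟩,
          point_unique hKL (meet_left hKL) (meet_right hKL) hKq hqL⟩
    · have : (Q.erase p).filter (fun q => PointOnLine q L ∧ PointOnLine q L') = {meet L L'} := by
        ext q
        simp only [Finset.mem_filter, Finset.mem_singleton, Finset.mem_erase, hQ]
        constructor
        · rintro ⟨_, h1, h2⟩
          exact point_unique heq h1 h2 (meet_left heq) (meet_right heq)
        · rintro rfl
          refine ⟨⟨?_, ?_⟩, meet_left heq, meet_right heq⟩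
          · intro h
            exact hL.2 (h ▸ meet_left heq)
          · exact isIntersectionPoint_of hL.1 hL'.1 heq (meet_left heq) (meet_right heq)
      rw [this]
      simp
  rw [← Finset.add_sum_erase Q _ ((hQ p).2 hpI)]
  have hrest : ∑ q ∈ Q.erase p, ((mult A q : ℤ) - 1) ^ 2
      = ∑ L ∈ H, ∑ L' ∈ H, if L = L' then (mult A p : ℤ) else 1 := by
    have e1 : ∑ q ∈ Q.erase p, ((mult A q : ℤ) - 1) ^ 2 = ∑ q ∈ Q.erase p, ∑ L ∈ H, ∑ L' ∈ H,
        if PointOnLine q L ∧ PointOnLine q L' then (1 : ℤ) else 0 := by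
      refine Finset.sum_congr rfl fun q hq => ?_
      rw [hone q hq, sq, Finset.sum_mul_sum]
      refine Finset.sum_congr rfl fun L _ => Finset.sum_congr rfl fun L' _ => ?_
      by_cases h1 : PointOnLine q L <;> by_cases h2 : PointOnLine q L' <;> simp [h1, h2]
    rw [e1, Finset.sum_comm]
    refine Finset.sum_congr rfl fun L hL => ?_
    rw [Finset.sum_comm]
    refine Finset.sum_congr rfl fun L' hL' => ?_
    rw [← hpair L hL L' hL', Finset.sum_boole]
  have hinner : ∀ L ∈ H, (∑ L' ∈ H, if L = L' then (mult A p : ℤ) else 1)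
      = mult A p + ((H.card : ℤ) - 1) := by
    intro L hL
    rw [← Finset.add_sum_erase H _ hL, if_pos rfl, Finset.sum_congr rfl (g := fun _ => (1 : ℤ))]
    · rw [Finset.sum_const, Finset.card_erase_of_mem hL]
      have : 1 ≤ H.card := Finset.card_pos.2 ⟨L, hL⟩
      rw [nsmul_eq_mul, mul_one, Nat.cast_sub this, Nat.cast_one]
    · intro L' hL'
      rw [if_neg (Finset.mem_erase.1 hL').1.symm]
  rw [hrest, Finset.sum_congr rfl hinner, Finset.sum_const, nsmul_eq_mul, hHc]
  ring

/-- Let `A` be a free line arrangement with `d` lines and let `m` be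
the maximal multiplicity of an intersection point of `A`. If `2m ≥ d` then the global
Tjurina number satisfies `Σ_{k≥2} n_k (k-1)² = (d-1)² - (m-1)(d-m)`. -/
theorem global_tjurina_of_free (A : Finset ProjLine) (m : ℕ)
    (hfree : IsFreeArr A)
    (hex : ∃ p : ProjPoint, IsIntersectionPoint A p ∧ mult A p = m)
    (hub : ∀ p : ProjPoint, IsIntersectionPoint A p → mult A p ≤ m)
    (hd : A.card ≤ 2 * m) :
    ∑ k ∈ Finset.Icc 2 A.card, (nk A k : ℤ) * ((k : ℤ) - 1) ^ 2
      = ((A.card : ℤ) - 1) ^ 2 - ((m : ℤ) - 1) * ((A.card : ℤ) - (m : ℤ)) := by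
  obtain ⟨p, hp, rfl⟩ := hex
  exact count_modular (modular_of_free hfree hp hd)

end
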